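/- arXiv:1305.1867 — 9 statements merged into one kernel-verified Lean document; each statement's English description precedes it below -/
import Mathlib

section
/- Let n ≥ 3 be an odd integer. Then ∑_{1 ≤ k ≤ n−1, gcd(k,n)=1} k^{n−1} ≡ φ(n) (mod n) if and only if p − 1 divides n − 1 for every prime p dividing n. In particular, an odd composite positive integer n is a weak Carmichael number if and only if p − 1 divides n − 1 for every prime divisor p of n. -/
/-- The sum `∑_{1 ≤ k ≤ n−1, gcd(k,n)=1} k^(n−1)`. -/
def carmSum (n : ℕ) : ℕ :=
  ∑ k ∈ Finset.filter (fun k => Nat.Coprime k n) (Finset.range n), k ^ (n - 1)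

/-- A composite positive integer `n` is a weak Carmichael number if
`∑_{1 ≤ k ≤ n−1, gcd(k,n)=1} k^(n−1) ≡ φ(n) (mod n)`. -/
def IsWeakCarmichael (n : ℕ) : Prop :=
  1 < n ∧ ¬ n.Prime ∧ carmSum n ≡ n.totient [MOD n]

/-- The sum of powers in `carmSum`, reduced modulo `n`, as a sum over the units of `ZMod n`. -/
theorem carmSum_cast (n : ℕ) [NeZero n] :
    (carmSum n : ZMod n) = ∑ u : (ZMod n)ˣ, (u : ZMod n) ^ (n - 1) := by
  unfold carmSum
  push_cast
  symm
  refine Finset.sum_bij (fun u _ => (u : ZMod n).val) ?_ ?_ ?_ ?_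
  · intro u _
    simp only [Finset.mem_filter, Finset.mem_range]
    exact ⟨ZMod.val_lt _, ZMod.val_coe_unit_coprime u⟩
  · intro u _ v _ h
    exact Units.ext (ZMod.val_injective n h)
  · intro k hk
    simp only [Finset.mem_filter, Finset.mem_range] at hk
    refine ⟨ZMod.unitOfCoprime k hk.2, Finset.mem_univ _, ?_⟩
    rw [ZMod.coe_unitOfCoprime, ZMod.val_natCast_of_lt hk.1]
  · intro u _
    rw [ZMod.natCast_zmod_val]

/-- An integer congruent to `1` modulo every prime divisor of `n` has `n`-th power `1` modulo `n`. -/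
theorem Int.natCast_dvd_pow_self_sub_one {n : ℕ} (a : ℤ)
    (h : ∀ p : ℕ, p.Prime → p ∣ n → (p : ℤ) ∣ a - 1) : (n : ℤ) ∣ a ^ n - 1 := by
  rw [Int.natCast_dvd, Nat.dvd_iff_prime_pow_dvd_dvd]
  intro p k hp hk
  rw [← Int.natCast_dvd]
  rcases Nat.eq_zero_or_pos k with rfl | hk0
  · simp
  have h1 := dvd_sub_pow_of_dvd_sub (h p hp ((dvd_pow_self p hk0.ne').trans hk)) k
  obtain ⟨c, hc⟩ := hk
  have h2 : a ^ p ^ k - 1 ∣ a ^ n - 1 := by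
    conv_rhs => rw [hc, pow_mul]
    exact sub_one_dvd_pow_sub_one _ _
  rw [one_pow] at h1
  push_cast
  exact ((pow_dvd_pow _ (Nat.le_succ k)).trans h1).trans h2

theorem ZMod.pow_self_eq_one {n : ℕ} (x : ZMod n)
    (h : ∀ p : ℕ, p.Prime → ∀ hp : p ∣ n, ZMod.castHom hp (ZMod p) x = 1) : x ^ n = 1 := by
  obtain ⟨a, rfl⟩ := ZMod.intCast_surjective x
  have := Int.natCast_dvd_pow_self_sub_one (n := n) a fun p hp hpn => by
    rw [← ZMod.intCast_zmod_eq_zero_iff_dvd]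
    have := h p hp hpn
    rw [map_intCast] at this
    push_cast
    rw [this, sub_self]
  rw [← ZMod.intCast_zmod_eq_zero_iff_dvd] at this
  push_cast at this
  exact sub_eq_zero.mp this

theorem sum_units_pow_eq_totient {n : ℕ} [NeZero n] (hodd : Odd n)
    (h : ∀ p : ℕ, p.Prime → p ∣ n → (p - 1) ∣ (n - 1)) :
    ∑ u : (ZMod n)ˣ, (u : ZMod n) ^ (n - 1) = (n.totient : ZMod n) := by
  have hn0 : n ≠ 0 := NeZero.ne n
  have hpow : ∀ u : (ZMod n)ˣ, ∀ p : ℕ, p.Prime → ∀ hp : p ∣ n,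
      ZMod.castHom hp (ZMod p) ((u : ZMod n) ^ (n - 1)) = 1 := by
    intro u p hp hpn
    have := Fact.mk hp
    obtain ⟨c, hc⟩ := h p hp hpn
    rw [map_pow, hc, pow_mul, ZMod.pow_card_sub_one_eq_one, one_pow]
    exact (u.isUnit.map (ZMod.castHom hpn (ZMod p))).ne_zero
  have hrefl : ∀ u : (ZMod n)ˣ, ∃ w : (ZMod n)ˣ, (w : ZMod n) = 2 - (u : ZMod n) ^ (n - 1) := by
    intro u
    have h1 : (2 - (u : ZMod n) ^ (n - 1)) ^ n = 1 := by
      refine ZMod.pow_self_eq_one _ fun p hp hpn => ?_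
      rw [map_sub, hpow u p hp hpn, map_ofNat]
      norm_num
    exact IsUnit.of_pow_eq_one h1 hn0
  choose w hw using hrefl
  have hyn : ∀ u : (ZMod n)ˣ, (u ^ (n - 1)) ^ n = 1 := by
    intro u
    apply Units.ext
    push_cast
    exact ZMod.pow_self_eq_one _ (hpow u)
  have hwn : ∀ u, w u ^ n = 1 := by
    intro u
    apply Units.ext
    push_cast
    refine ZMod.pow_self_eq_one _ fun p hp hpn => ?_
    rw [hw, map_sub, hpow u p hp hpn, map_ofNat]
    norm_num
  have hinv : ∀ x : (ZMod n)ˣ, x ^ n = 1 → x ^ (n - 1) = x⁻¹ := by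
    intro x hx
    rw [eq_inv_iff_mul_eq_one, pow_sub_one_mul hn0, hx]
  -- the involution `u ↦ u * y / (2 - y)`, where `y = u ^ (n - 1)`, replaces `y` by `2 - y`
  let σ : (ZMod n)ˣ → (ZMod n)ˣ := fun u => u * (u ^ (n - 1) * (w u)⁻¹)
  have hσ : ∀ u, σ u ^ (n - 1) = w u := by
    intro u
    have h1 : (u ^ (n - 1) * (w u)⁻¹) ^ n = 1 := by
      rw [mul_pow, hyn, inv_pow, hwn, inv_one, mul_one]
    simp only [σ]
    rw [mul_pow, hinv _ h1]
    simp
  have hwσ : ∀ u, w (σ u) = u ^ (n - 1) := by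
    intro u
    apply Units.ext
    rw [hw, ← Units.val_pow_eq_pow_val, hσ, hw]
    push_cast
    ring
  have hinvol : Function.Involutive σ := by
    intro u
    change σ u * (σ u ^ (n - 1) * (w (σ u))⁻¹) = u
    rw [hσ, hwσ]
    simp only [σ]
    group
  have hsum := Equiv.sum_comp (hinvol.toPerm σ) fun u : (ZMod n)ˣ => (u : ZMod n) ^ (n - 1)
  have hval : ∀ u : (ZMod n)ˣ, ((hinvol.toPerm σ u : (ZMod n)ˣ) : ZMod n) ^ (n - 1)
      = 2 - (u : ZMod n) ^ (n - 1) := by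
    intro u
    rw [← hw, ← hσ]
    rfl
  simp only [hval, Finset.sum_sub_distrib, Finset.sum_const, Finset.card_univ,
    ZMod.card_units_eq_totient, nsmul_eq_mul] at hsum
  have h2 : IsUnit (2 : ZMod n) := by
    have := (ZMod.isUnit_iff_coprime 2 n).mpr (Nat.coprime_two_left.mpr hodd)
    exact_mod_cast this
  apply h2.mul_left_cancel
  linear_combination -hsum

theorem exists_prime_dvd_sub_one_of_sum_units_pow {n p : ℕ} [NeZero n] (hp : p.Prime) (hpn : p ∣ n)
    (hnd : ¬ (p - 1) ∣ (n - 1))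
    (hsum : ∑ u : (ZMod n)ˣ, (u : ZMod n) ^ (n - 1) = (n.totient : ZMod n)) :
    ∃ q : ℕ, q.Prime ∧ q ∣ n ∧ p ∣ q - 1 := by
  have := Fact.mk hp
  have hx : ∃ x : (ZMod p)ˣ, x ^ (n - 1) ≠ 1 := by
    by_contra! hcon
    apply hnd
    have := (FiniteField.forall_pow_eq_one_iff (ZMod p) (n - 1)).mp hcon
    rwa [ZMod.card] at this
  obtain ⟨x, hx⟩ := hx
  obtain ⟨g, rfl⟩ := ZMod.unitsMap_surjective hpn x
  have hmul : (n.totient : ZMod n) * ((g : ZMod n) ^ (n - 1) - 1) = 0 := by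
    have h1 := Equiv.sum_comp (Equiv.mulRight g) fun u : (ZMod n)ˣ => (u : ZMod n) ^ (n - 1)
    simp only [Equiv.coe_mulRight, Units.val_mul, mul_pow, ← Finset.sum_mul, hsum] at h1
    linear_combination h1
  set a : ℕ := ((g : ZMod n) ^ (n - 1) - 1).val with ha
  have hacast : (a : ZMod n) = (g : ZMod n) ^ (n - 1) - 1 := ZMod.natCast_zmod_val _
  have hpa : ¬ p ∣ a := by
    intro hdvd
    rw [← ZMod.natCast_eq_zero_iff] at hdvd
    have h1 := congrArg (ZMod.castHom hpn (ZMod p)) hacast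
    rw [map_natCast, hdvd, map_sub, map_pow, map_one] at h1
    apply hx
    apply Units.ext
    push_cast
    exact (sub_eq_zero.mp h1.symm)
  have hna : n ∣ n.totient * a := by
    rw [← ZMod.natCast_eq_zero_iff]
    push_cast
    rw [hacast, hmul]
  obtain ⟨e, m, hm, hnm⟩ := Nat.exists_eq_pow_mul_and_not_dvd (NeZero.ne n) p hp.ne_one
  have hpe : p ^ e ∣ n.totient := by
    refine Nat.Coprime.dvd_of_dvd_mul_right ?_ ((Dvd.intro m hnm.symm).trans hna)
    exact ((Nat.Prime.coprime_iff_not_dvd hp).mpr hpa).pow_left e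
  have hrad : p ∣ ∏ q ∈ n.primeFactors, q :=
    Finset.dvd_prod_of_mem (fun q => q) (Nat.mem_primeFactors.mpr ⟨hp, hpn, NeZero.ne n⟩)
  have hdvd := mul_dvd_mul hpe hrad
  rw [Nat.totient_mul_prod_primeFactors] at hdvd
  have hdvd' : p ^ e * p ∣ p ^ e * (m * ∏ q ∈ n.primeFactors, (q - 1)) := by
    rwa [← mul_assoc, ← hnm]
  have h3 := Nat.dvd_of_mul_dvd_mul_left (pow_pos hp.pos e) hdvd'
  obtain ⟨q, hq, hpq⟩ := (hp.prime.dvd_finsetProd_iff _).mp ((hp.dvd_mul.mp h3).resolve_left hm)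
  exact ⟨q, Nat.prime_of_mem_primeFactors hq, Nat.dvd_of_mem_primeFactors hq, hpq⟩

theorem sub_one_dvd_of_sum_units_pow {n : ℕ} [NeZero n]
    (hsum : ∑ u : (ZMod n)ˣ, (u : ZMod n) ^ (n - 1) = (n.totient : ZMod n))
    (p : ℕ) (hp : p.Prime) (hpn : p ∣ n) : (p - 1) ∣ (n - 1) := by
  by_contra hnd
  obtain ⟨r, hr, hmax⟩ := Finset.exists_max_image
    (n.primeFactors.filter fun q => ¬ (q - 1) ∣ (n - 1)) (fun q => q)
    ⟨p, Finset.mem_filter.mpr ⟨Nat.mem_primeFactors.mpr ⟨hp, hpn, NeZero.ne n⟩, hnd⟩⟩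
  simp only [Finset.mem_filter, Nat.mem_primeFactors] at hr hmax
  obtain ⟨⟨hrp, hrn, hn0⟩, hrd⟩ := hr
  obtain ⟨q, hq, hqn, hrq⟩ := exists_prime_dvd_sub_one_of_sum_units_pow hrp hrn hrd hsum
  have hlt : r ≤ q - 1 := Nat.le_of_dvd (Nat.sub_pos_of_lt hq.one_lt) hrq
  have hq1 := hq.one_lt
  by_cases hqd : (q - 1) ∣ (n - 1)
  · have h1 := (Nat.dvd_sub_iff_right (Nat.one_le_iff_ne_zero.mpr hn0) hrn).mp (hrq.trans hqd)
    exact hrp.one_lt.ne' (Nat.dvd_one.mp h1)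
  · have := hmax q ⟨⟨hq, hqn, hn0⟩, hqd⟩
    omega

theorem carmSum_modEq_totient_iff {n : ℕ} [NeZero n] (hodd : Odd n) :
    carmSum n ≡ n.totient [MOD n] ↔ ∀ p : ℕ, p.Prime → p ∣ n → (p - 1) ∣ (n - 1) := by
  rw [← ZMod.natCast_eq_natCast_iff, carmSum_cast]
  exact ⟨sub_one_dvd_of_sum_units_pow, sum_units_pow_eq_totient hodd⟩

theorem stmt_0 (n : ℕ) (hn : 3 ≤ n) (hodd : Odd n) :
    (carmSum n ≡ n.totient [MOD n] ↔
      ∀ p : ℕ, p.Prime → p ∣ n → (p - 1) ∣ (n - 1)) ∧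
    (¬ n.Prime →
      (IsWeakCarmichael n ↔ ∀ p : ℕ, p.Prime → p ∣ n → (p - 1) ∣ (n - 1))) := by
  have : NeZero n := ⟨by omega⟩
  refine ⟨carmSum_modEq_totient_iff hodd, fun hnp => ?_⟩
  rw [← carmSum_modEq_totient_iff hodd]
  exact ⟨fun h => h.2.2, fun h => ⟨by omega, hnp, h⟩⟩
end

section
/- Every weak Carmichael number is odd; that is, no even composite positive integer n satisfies ∑_{1 ≤ k ≤ n−1, gcd(k,n)=1} k^{n−1} ≡ φ(n) (mod n). -/
theorem natCast_carmSum_eq_zero {n : ℕ} (hn : 2 < n) (he : Even n) :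
    (carmSum n : ZMod n) = 0 := by
  have hodd : Odd (n - 1) := Nat.Even.sub_odd (by omega) he odd_one
  have hpos : ∀ k, Nat.Coprime k n → k ≠ 0 := by
    rintro k hk rfl
    have := (Nat.coprime_zero_left n).mp hk
    omega
  unfold carmSum
  push_cast
  refine Finset.sum_involution (fun k _ => n - k) ?_ ?_ ?_ ?_
  · intro k hk
    simp only [Finset.mem_filter, Finset.mem_range] at hk
    rw [Nat.cast_sub hk.1.le, ZMod.natCast_self, zero_sub, hodd.neg_pow, add_neg_cancel]
  · intro k hk _ heq
    simp only [Finset.mem_filter, Finset.mem_range] at hk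
    have hdvd : k ∣ n := ⟨2, by omega⟩
    have := Nat.Coprime.eq_one_of_dvd hk.2 hdvd
    omega
  · intro k hk
    simp only [Finset.mem_filter, Finset.mem_range] at hk ⊢
    have := hpos k hk.2
    exact ⟨by omega, (Nat.coprime_self_sub_left hk.1.le).mpr hk.2⟩
  · intro k hk
    simp only [Finset.mem_filter, Finset.mem_range] at hk
    omega

theorem stmt_1 (n : ℕ) (h : IsWeakCarmichael n) : Odd n := by
  obtain ⟨h1, hp, hmod⟩ := h
  by_contra hodd
  have he : Even n := Nat.not_odd_iff_even.mp hodd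
  have hn : 2 < n := lt_of_le_of_ne h1 (by rintro rfl; exact hp Nat.prime_two)
  have hφ : (n.totient : ZMod n) = 0 := by
    rw [← (ZMod.natCast_eq_natCast_iff _ _ _).mpr hmod, natCast_carmSum_eq_zero hn he]
  have hdvd := (ZMod.natCast_eq_zero_iff _ _).mp hφ
  exact absurd (Nat.le_of_dvd (Nat.totient_pos.mpr (by omega)) hdvd)
    (Nat.totient_lt n h1).not_ge
end

section
/- An odd composite positive integer n is a weak Carmichael number if and only if 2·∑_{1 ≤ k < n/2, gcd(k,n)=1} k^{n−1} ≡ φ(n) (mod n), where the sum ranges over the reduced residues modulo n that are smaller than n/2 (the first half r_1 < r_2 < ⋯ < r_{φ(n)/2} of the reduced residues modulo n). -/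
/-- For odd `n > 1`, the reflection `k ↦ n - k` folds `carmSum n` onto the first half of the
reduced residues. -/
lemma carmSum_modEq_two_mul_sum_first_half (n : ℕ) (hodd : Odd n) (hn : 1 < n) :
    carmSum n ≡ 2 * (∑ k ∈ Finset.filter (fun k => Nat.Coprime k n ∧ 2 * k < n)
        (Finset.range n), k ^ (n - 1)) [MOD n] := by
  have heven : Even (n - 1) := Nat.Odd.sub_odd hodd odd_one
  have hpos : ∀ k, Nat.Coprime k n → 0 < k := by
    rintro k hk
    rcases Nat.eq_zero_or_pos k with rfl | h
    · rw [Nat.coprime_zero_left] at hk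
      omega
    · exact h
  rw [← ZMod.natCast_eq_natCast_iff, carmSum,
    ← Finset.sum_filter_add_sum_filter_not _ (fun k => 2 * k < n), Finset.filter_filter,
    Finset.filter_filter]
  push_cast
  rw [two_mul]
  congr 1
  refine Finset.sum_bij' (fun k _ => n - k) (fun k _ => n - k) ?_ ?_ ?_ ?_ ?_
  · intro k hk
    simp only [Finset.mem_filter, Finset.mem_range] at hk ⊢
    obtain ⟨hkn, hc, h2⟩ := hk
    have := hpos k hc
    obtain ⟨m, rfl⟩ := hodd
    exact ⟨by omega, (Nat.coprime_self_sub_left hkn.le).2 hc, by omega⟩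
  · intro k hk
    simp only [Finset.mem_filter, Finset.mem_range] at hk ⊢
    obtain ⟨hkn, hc, h2⟩ := hk
    have := hpos k hc
    exact ⟨by omega, (Nat.coprime_self_sub_left hkn.le).2 hc, by omega⟩
  · intro k hk
    simp only [Finset.mem_filter, Finset.mem_range] at hk
    omega
  · intro k hk
    simp only [Finset.mem_filter, Finset.mem_range] at hk
    omega
  · intro k hk
    simp only [Finset.mem_filter, Finset.mem_range] at hk
    rw [Nat.cast_sub hk.1.le, ZMod.natCast_self, zero_sub, heven.neg_pow]

theorem stmt_2 (n : ℕ) (hodd : Odd n) (hn : 1 < n) (hnp : ¬ n.Prime) :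
    IsWeakCarmichael n ↔
      2 * (∑ k ∈ Finset.filter (fun k => Nat.Coprime k n ∧ 2 * k < n)
        (Finset.range n), k ^ (n - 1)) ≡ n.totient [MOD n] := by
  have h := carmSum_modEq_two_mul_sum_first_half n hodd hn
  exact ⟨fun hw => h.symm.trans hw.2.2, fun hs => ⟨hn, hnp, h.trans hs⟩⟩
end

section
/- A composite positive integer n is a Carmichael number if and only if the following two conditions are satisfied: (i) n is square-free, and (ii) ∑_{1 ≤ k ≤ n−1, gcd(k,n)=1} k^{n−1} ≡ φ(n) (mod n). -/
/-- A composite positive integer `n` is a Carmichael number if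
`a^(n−1) ≡ 1 (mod n)` for every integer `a` coprime to `n`. -/
def IsCarmichael (n : ℕ) : Prop :=
  1 < n ∧ ¬ n.Prime ∧ ∀ a : ℕ, Nat.Coprime a n → a ^ (n - 1) ≡ 1 [MOD n]

theorem one_add_pow_of_sq_eq_zero {R : Type*} [CommRing R] {t : R} (ht : t ^ 2 = 0) (k : ℕ) :
    (1 + t) ^ k = 1 + k * t := by
  induction k with
  | zero => simp
  | succ k ih =>
    rw [pow_succ, ih]
    push_cast
    linear_combination (k : R) * ht

theorem IsCarmichael.squarefree {n : ℕ} (h : IsCarmichael n) : Squarefree n := by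
  obtain ⟨hn, -, h⟩ := h
  rintro x ⟨m, hm⟩
  have ht : ((x * m : ℕ) : ZMod n) ^ 2 = 0 := by
    rw [← Nat.cast_pow, ZMod.natCast_eq_zero_iff]
    exact ⟨m, by rw [hm]; ring⟩
  have hcop : Nat.Coprime (1 + x * m) n := by
    rw [← ZMod.isUnit_iff_coprime, Nat.cast_add, Nat.cast_one]
    exact IsUnit.of_mul_eq_one (1 - ((x * m : ℕ) : ZMod n)) (by linear_combination -ht)
  have h1 := (ZMod.natCast_eq_natCast_iff _ _ _).2 (h _ hcop)
  have h2 := one_add_pow_of_sq_eq_zero ht n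
  rw [← Nat.sub_add_cancel hn.le, pow_succ, Nat.sub_add_cancel hn.le] at h2
  push_cast at h1 h2
  rw [h1, ZMod.natCast_self, one_mul, zero_mul, add_zero] at h2
  have h3 : ((x * m : ℕ) : ZMod n) = 0 := by
    push_cast
    linear_combination h2
  rw [ZMod.natCast_eq_zero_iff] at h3
  have hpos : 0 < x * m := by
    rcases Nat.eq_zero_or_pos (x * m) with h0 | h0
    · rw [mul_assoc, h0, mul_zero] at hm
      omega
    · exact h0
  have hle := Nat.le_of_dvd hpos h3
  rw [Nat.isUnit_iff]
  have hx : 0 < x := Nat.pos_of_mul_pos_right hpos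
  nlinarith [mul_assoc x x m]

theorem IsCarmichael.carmSum_modEq {n : ℕ} (h : IsCarmichael n) :
    carmSum n ≡ n.totient [MOD n] := by
  rw [← ZMod.natCast_eq_natCast_iff, carmSum, Nat.cast_sum, Finset.sum_congr rfl
    (g := fun _ => (1 : ZMod n))]
  · simp [Nat.totient, Nat.coprime_comm]
  · intro k hk
    simpa using (ZMod.natCast_eq_natCast_iff _ _ _).2 (h.2.2 k (Finset.mem_filter.1 hk).2)

theorem carmSum_eq_sum_units (n : ℕ) [NeZero n] :
    carmSum n = ∑ u : (ZMod n)ˣ, (u : ZMod n).val ^ (n - 1) := by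
  refine Finset.sum_bij' (fun k hk => ZMod.unitOfCoprime k (Finset.mem_filter.1 hk).2)
    (fun u _ => (u : ZMod n).val) ?_ ?_ ?_ ?_ ?_
  · simp
  · intro u _
    simpa using ⟨ZMod.val_lt _, ZMod.val_coe_unit_coprime u⟩
  · intro k hk
    simpa using ZMod.val_cast_of_lt (Finset.mem_range.1 (Finset.mem_filter.1 hk).1)
  · intro u _
    ext
    simp
  · intro k hk
    simp [ZMod.val_cast_of_lt (Finset.mem_range.1 (Finset.mem_filter.1 hk).1)]

theorem dvd_carmSum_of_not_sub_one_dvd {n p : ℕ} (hn : n ≠ 0) (hp : p.Prime) (hpn : p ∣ n)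
    (h : ¬ p - 1 ∣ n - 1) : p ∣ carmSum n := by
  have : NeZero n := ⟨hn⟩
  have : Fact p.Prime := ⟨hp⟩
  let f : (ZMod n)ˣ →* ZMod p :=
    (powMonoidHom (n - 1)).comp ((Units.coeHom (ZMod p)).comp (ZMod.unitsMap hpn))
  have hf : f ≠ 1 := by
    intro hf
    apply h
    rw [← ZMod.card p, ← FiniteField.forall_pow_eq_one_iff (ZMod p)]
    intro v
    obtain ⟨u, rfl⟩ := ZMod.unitsMap_surjective hpn v
    ext
    simpa [f] using DFunLike.congr_fun hf u
  rw [← ZMod.natCast_eq_zero_iff, carmSum_eq_sum_units, ← sum_hom_units_eq_zero f hf]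
  push_cast
  refine Finset.sum_congr rfl fun u _ => ?_
  simp [f, ZMod.unitsMap_def]

theorem Squarefree.exists_prime_dvd_sub_one_of_dvd_totient {n p : ℕ} (hn : Squarefree n)
    (hp : p.Prime) (h : p ∣ n.totient) : ∃ q, q.Prime ∧ q ∣ n ∧ p ∣ q - 1 := by
  rw [Nat.totient_eq_div_primeFactors_mul, Nat.prod_primeFactors_of_squarefree hn,
    Nat.div_self (Nat.pos_of_ne_zero hn.ne_zero), one_mul, hp.prime.dvd_finsetProd_iff] at h
  obtain ⟨q, hq, hpq⟩ := h
  exact ⟨q, Nat.prime_of_mem_primeFactors hq, Nat.dvd_of_mem_primeFactors hq, hpq⟩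

theorem sub_one_dvd_of_carmSum_modEq {n : ℕ} (hn : 1 < n) (hsq : Squarefree n)
    (h : carmSum n ≡ n.totient [MOD n]) (p : ℕ) (hp : p.Prime) (hpn : p ∣ n) :
    p - 1 ∣ n - 1 := by
  by_contra hndvd
  obtain ⟨q, hq, hqn, hpq⟩ := hsq.exists_prime_dvd_sub_one_of_dvd_totient hp
    ((h.dvd_iff hpn).1 (dvd_carmSum_of_not_sub_one_dvd (by omega) hp hpn hndvd))
  have hlt : p < q := by
    have := Nat.le_of_dvd (Nat.sub_pos_of_lt hq.one_lt) hpq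
    have := hq.one_lt
    omega
  have hqle : q ≤ n := Nat.le_of_dvd (by omega) hqn
  have hdvd := hpq.trans (sub_one_dvd_of_carmSum_modEq hn hsq h q hq hqn)
  have h1 := (Nat.dvd_sub_iff_right hn.le hpn).1 hdvd
  exact hp.one_lt.ne' (Nat.dvd_one.1 h1)
termination_by n - p

/-- The sufficiency half of Korselt's criterion. -/
theorem pow_sub_one_modEq_one_of_korselt {n : ℕ} (hsq : Squarefree n)
    (h : ∀ p : ℕ, p.Prime → p ∣ n → p - 1 ∣ n - 1) {a : ℕ} (ha : a.Coprime n) :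
    a ^ (n - 1) ≡ 1 [MOD n] := by
  apply Nat.ModEq.symm
  rw [Nat.modEq_iff_dvd]
  nth_rw 1 [← Nat.prod_primeFactors_of_squarefree hsq]
  rw [Nat.cast_prod]
  refine Finset.prod_dvd_of_coprime (fun p hp q hq hpq => ?_) (fun p hp => ?_)
  · exact Nat.isCoprime_iff_coprime.2 ((Nat.coprime_primes (Nat.prime_of_mem_primeFactors hp)
      (Nat.prime_of_mem_primeFactors hq)).2 hpq)
  · have hpp := Nat.prime_of_mem_primeFactors hp
    have hpn := Nat.dvd_of_mem_primeFactors hp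
    rw [← Nat.modEq_iff_dvd]
    obtain ⟨k, hk⟩ := h p hpp hpn
    have h1 := (Nat.ModEq.pow_totient (ha.coprime_dvd_right hpn)).pow k
    rw [one_pow, Nat.totient_prime hpp, ← pow_mul, ← hk] at h1
    exact h1.symm

theorem stmt_3 (n : ℕ) (hn : 1 < n) (hnp : ¬ n.Prime) :
    IsCarmichael n ↔ Squarefree n ∧ carmSum n ≡ n.totient [MOD n] :=
  ⟨fun h => ⟨h.squarefree, h.carmSum_modEq⟩, fun ⟨hsq, h⟩ => ⟨hn, hnp, fun _ ha =>
    pow_sub_one_modEq_one_of_korselt hsq (sub_one_dvd_of_carmSum_modEq hn hsq h) ha⟩⟩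
end

section
/- An integer n > 1 is a weak Carmichael number which is not a Carmichael number if and only if ∑_{1 ≤ k ≤ n−1, gcd(k,n)=1} k^{n−1} ≡ φ(n) + μ(n) (mod n), where μ is the Möbius function. -/
theorem carmSum_cast_eq_sum_units {n p : ℕ} [NeZero n] (hpn : p ∣ n) :
    (carmSum n : ZMod p) = ∑ u : (ZMod n)ˣ, (ZMod.unitsMap hpn u : ZMod p) ^ (n - 1) := by
  rw [carmSum, Nat.cast_sum]
  symm
  refine Finset.sum_bij (fun u _ => (u : ZMod n).val) ?_ ?_ ?_ ?_
  · intro u _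
    simp only [Finset.mem_filter, Finset.mem_range]
    exact ⟨ZMod.val_lt _, ZMod.val_coe_unit_coprime u⟩
  · intro u _ v _ h
    exact Units.ext (ZMod.val_injective n h)
  · intro k hk
    simp only [Finset.mem_filter, Finset.mem_range] at hk
    refine ⟨ZMod.unitOfCoprime k hk.2, Finset.mem_univ _, ?_⟩
    rw [ZMod.coe_unitOfCoprime, ZMod.val_natCast_of_lt hk.1]
  · intro u _
    rw [Nat.cast_pow, ZMod.unitsMap_val, ZMod.cast_eq_val]

theorem carmSum_cast_of_sub_one_dvd {n p : ℕ} [NeZero n] [Fact p.Prime] (hpn : p ∣ n)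
    (h : p - 1 ∣ n - 1) : (carmSum n : ZMod p) = n.totient := by
  obtain ⟨c, hc⟩ := h
  rw [carmSum_cast_eq_sum_units hpn, ← ZMod.card_units_eq_totient n]
  have hone (u : (ZMod n)ˣ) : (ZMod.unitsMap hpn u : ZMod p) ^ (n - 1) = 1 := by
    rw [hc, pow_mul, ZMod.pow_card_sub_one_eq_one (Units.ne_zero _), one_pow]
  simp [hone]

theorem carmSum_cast_of_not_sub_one_dvd {n p : ℕ} [NeZero n] [Fact p.Prime] (hpn : p ∣ n)
    (h : ¬ p - 1 ∣ n - 1) : (carmSum n : ZMod p) = 0 := by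
  have hex : ∃ v : (ZMod p)ˣ, v ^ (n - 1) ≠ 1 := by
    by_contra! hall
    exact h (by simpa [ZMod.card] using (FiniteField.forall_pow_eq_one_iff (ZMod p) (n - 1)).1 hall)
  obtain ⟨v, hv⟩ := hex
  obtain ⟨w, rfl⟩ := ZMod.unitsMap_surjective hpn v
  rw [carmSum_cast_eq_sum_units hpn]
  set S := ∑ u : (ZMod n)ˣ, (ZMod.unitsMap hpn u : ZMod p) ^ (n - 1) with hS
  have hmul : (ZMod.unitsMap hpn w : ZMod p) ^ (n - 1) * S = S := by
    rw [hS, Finset.mul_sum]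
    refine Fintype.sum_equiv (Equiv.mulLeft w) _ _ fun u => ?_
    rw [Equiv.coe_mulLeft, map_mul, Units.val_mul, mul_pow]
  by_contra hne
  exact hv (Units.ext (by simpa using mul_right_cancel₀ hne (hmul.trans (one_mul S).symm)))

theorem Squarefree.dvd_of_forall_prime_dvd {n x : ℕ} (hn : Squarefree n)
    (h : ∀ p, p.Prime → p ∣ n → p ∣ x) : n ∣ x := by
  rw [← Nat.prod_primeFactors_of_squarefree hn]
  exact Finset.prod_primes_dvd x (fun p hp => (Nat.prime_of_mem_primeFactors hp).prime)
    fun p hp => h p (Nat.prime_of_mem_primeFactors hp) (Nat.dvd_of_mem_primeFactors hp)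

/-- The sufficiency half of the Korselt criterion. -/
theorem isCarmichael_of_squarefree {n : ℕ} (hn : 1 < n) (hnp : ¬ n.Prime) (hsq : Squarefree n)
    (h : ∀ p, p.Prime → p ∣ n → p - 1 ∣ n - 1) : IsCarmichael n := by
  refine ⟨hn, hnp, fun a ha => ?_⟩
  have ha0 : a ≠ 0 := by rintro rfl; simp at ha; omega
  have hle : 1 ≤ a ^ (n - 1) := Nat.one_le_pow _ _ (Nat.pos_of_ne_zero ha0)
  refine ((Nat.modEq_iff_dvd' hle).2 (hsq.dvd_of_forall_prime_dvd fun p hp hpn => ?_)).symm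
  have : Fact p.Prime := ⟨hp⟩
  obtain ⟨c, hc⟩ := h p hp hpn
  rw [← Nat.modEq_iff_dvd' hle, ← ZMod.natCast_eq_natCast_iff, Nat.cast_pow, hc, pow_mul,
    ZMod.pow_card_sub_one_eq_one, one_pow, Nat.cast_one]
  rw [Ne, ZMod.natCast_eq_zero_iff]
  exact fun hpa => hp.one_lt.ne' (Nat.eq_one_of_dvd_coprimes ha hpa hpn)

theorem IsWeakCarmichael.isCarmichael_of_squarefree {n : ℕ} (h : IsWeakCarmichael n)
    (hsq : Squarefree n) : IsCarmichael n := by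
  obtain ⟨hn, hnp, hsum⟩ := h
  have : NeZero n := ⟨by omega⟩
  refine _root_.isCarmichael_of_squarefree hn hnp hsq ?_
  by_contra! hbad
  let B := n.primeFactors.filter fun p => ¬ p - 1 ∣ n - 1
  have hB : B.Nonempty := by
    obtain ⟨p, hp, hpn, hd⟩ := hbad
    exact ⟨p, Finset.mem_filter.2 ⟨Nat.mem_primeFactors.2 ⟨hp, hpn, by omega⟩, hd⟩⟩
  obtain ⟨q, hqB, hmax⟩ := B.exists_max_image id hB
  obtain ⟨hq, hqd⟩ := Finset.mem_filter.1 hqB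
  have hqp := Nat.prime_of_mem_primeFactors hq
  have hqn := Nat.dvd_of_mem_primeFactors hq
  have : Fact q.Prime := ⟨hqp⟩
  have htot : q ∣ n.totient := by
    rw [← ZMod.natCast_eq_zero_iff,
      ← (ZMod.natCast_eq_natCast_iff _ _ _).2 (hsum.of_dvd hqn),
      carmSum_cast_of_not_sub_one_dvd hqn hqd]
  have hprod : n.totient = ∏ p ∈ n.primeFactors, (p - 1) := by
    have := Nat.totient_mul_prod_primeFactors n
    rw [Nat.prod_primeFactors_of_squarefree hsq, mul_comm] at this
    exact Nat.eq_of_mul_eq_mul_left (by omega) this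
  rw [hprod, hqp.prime.dvd_finsetProd_iff] at htot
  obtain ⟨p, hp, hqp1⟩ := htot
  have hpp := Nat.prime_of_mem_primeFactors hp
  have hlt : q < p := by
    have := Nat.le_of_dvd (by have := hpp.two_le; omega) hqp1
    have := hpp.two_le
    omega
  have hpd : p - 1 ∣ n - 1 := by
    by_contra hpd
    exact absurd (hmax p (Finset.mem_filter.2 ⟨hp, hpd⟩)) (not_le.2 hlt)
  have h1 : q ∣ 1 := by
    have := Nat.dvd_sub hqn (hqp1.trans hpd)
    rwa [Nat.sub_sub_self hn.le] at this
  exact hqp.one_lt.ne' (Nat.dvd_one.1 h1)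

theorem not_carmSum_modEq_of_squarefree {n : ℕ} (hn : 1 < n) (hsq : Squarefree n) :
    ¬ (carmSum n : ℤ) ≡ (n.totient : ℤ) + ArithmeticFunction.moebius n [ZMOD (n : ℤ)] := by
  intro h
  have : NeZero n := ⟨by omega⟩
  have hμ : ArithmeticFunction.moebius n = 1 ∨ ArithmeticFunction.moebius n = -1 :=
    ArithmeticFunction.moebius_ne_zero_iff_eq_or.1
      (ArithmeticFunction.moebius_ne_zero_iff_squarefree.2 hsq)
  have hcast (p : ℕ) (hpn : p ∣ n) :
      (carmSum n : ZMod p) = n.totient + (ArithmeticFunction.moebius n : ZMod p) := by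
    have := (ZMod.intCast_eq_intCast_iff _ _ _).2 (h.of_dvd (Int.natCast_dvd_natCast.2 hpn))
    simpa using this
  have hnd (p : ℕ) (hp : p.Prime) (hpn : p ∣ n) : ¬ p - 1 ∣ n - 1 := by
    intro hd
    have : Fact p.Prime := ⟨hp⟩
    have h1 := hcast p hpn
    rw [carmSum_cast_of_sub_one_dvd hpn hd, left_eq_add] at h1
    rcases hμ with hμ | hμ <;> simp [hμ] at h1
  have hdvd : (n : ℤ) ∣ n.totient + ArithmeticFunction.moebius n := by
    rw [← Int.dvd_natAbs, Int.natCast_dvd_natCast]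
    refine hsq.dvd_of_forall_prime_dvd fun p hp hpn => ?_
    have : Fact p.Prime := ⟨hp⟩
    rw [← Int.natCast_dvd_natCast, Int.dvd_natAbs, ← ZMod.intCast_zmod_eq_zero_iff_dvd,
      Int.cast_add, Int.cast_natCast, ← hcast p hpn,
      carmSum_cast_of_not_sub_one_dvd hpn (hnd p hp hpn)]
  have hnp : ¬ n.Prime := fun hp => hnd n hp dvd_rfl dvd_rfl
  have hlt := Nat.totient_lt n hn
  have hpos : 0 < n.totient := Nat.totient_pos.2 (by omega)
  have hne : n.totient ≠ n - 1 := fun h => hnp ((Nat.totient_eq_iff_prime (by omega)).1 h)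
  have hne2 : n.totient = 1 → n = 2 := fun h => by
    rcases Nat.totient_eq_one_iff.1 h with h | h <;> omega
  have hn2 : n ≠ 2 := fun h => hnp (h ▸ Nat.prime_two)
  rcases hμ with hμ | hμ <;> rw [hμ] at hdvd
  · have := Int.le_of_dvd (by omega) hdvd
    omega
  · have := Int.le_of_dvd (by omega) hdvd
    omega

theorem stmt_4 (n : ℕ) (hn : 1 < n) :
    (IsWeakCarmichael n ∧ ¬ IsCarmichael n) ↔
      (carmSum n : ℤ) ≡ (n.totient : ℤ) + ArithmeticFunction.moebius n
        [ZMOD (n : ℤ)] := by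
  by_cases hsq : Squarefree n
  · exact iff_of_false (fun h => h.2 (h.1.isCarmichael_of_squarefree hsq))
      (not_carmSum_modEq_of_squarefree hn hsq)
  · rw [ArithmeticFunction.moebius_eq_zero_of_not_squarefree hsq, add_zero,
      Int.natCast_modEq_iff]
    exact ⟨fun h => h.1.2.2, fun h =>
      ⟨⟨hn, fun hp => hsq hp.prime.squarefree, h⟩, fun hc => hsq hc.squarefree⟩⟩
end

section
/- Every power p^e of an odd prime p with exponent e ≥ 2 is a weak Carmichael number. -/
theorem sum_range_mul_eq_sum_sum {M : Type*} [AddCommMonoid M] (f : ℕ → M) (n c : ℕ) :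
    ∑ k ∈ Finset.range (n * c), f k =
      ∑ a ∈ Finset.range n, ∑ b ∈ Finset.range c, f (a + n * b) := by
  rw [Finset.sum_comm]
  induction c with
  | zero => simp
  | succ c ih =>
    rw [Nat.mul_succ, Finset.sum_range_add, ih, Finset.sum_range_succ]
    simp only [add_comm]

theorem sum_range_add_mul_pow_modEq {p m : ℕ} (hodd : Odd p) (hm : 1 ≤ m) (a N : ℕ) :
    ∑ b ∈ Finset.range p, (a + p ^ m * b) ^ N ≡ p * a ^ N [MOD p ^ (m + 1)] := by
  have hlin : ∀ b : ℕ, (a + p ^ m * b) ^ N ≡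
      a ^ N + N * a ^ (N - 1) * p ^ m * b [MOD p ^ (m + 1)] := by
    intro b
    obtain ⟨k, hk⟩ := Polynomial.powAddExpansion a (p ^ m * b) N
    have hdvd : p ^ (m + 1) ∣ k * (p ^ m * b) ^ 2 := by
      rw [mul_pow, ← pow_mul]
      exact ((pow_dvd_pow p (by lia)).mul_right _).mul_left _
    rw [hk, ← mul_assoc]
    exact (Nat.modEq_zero_iff_dvd.mpr hdvd).add_left _
  obtain ⟨r, hr⟩ := hodd
  have hid : ∑ b ∈ Finset.range p, b = p * r := by
    have h := Finset.sum_range_id_mul_two p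
    have h' : p - 1 = 2 * r := by lia
    rw [h'] at h
    linarith
  have hdvd : p ^ (m + 1) ∣ N * a ^ (N - 1) * p ^ m * (p * r) :=
    ⟨N * a ^ (N - 1) * r, by ring⟩
  calc ∑ b ∈ Finset.range p, (a + p ^ m * b) ^ N
      ≡ ∑ b ∈ Finset.range p, (a ^ N + N * a ^ (N - 1) * p ^ m * b) [MOD p ^ (m + 1)] :=
        Nat.ModEq.sum fun b _ => hlin b
    _ = p * a ^ N + N * a ^ (N - 1) * p ^ m * (p * r) := by
        rw [Finset.sum_add_distrib, ← Finset.mul_sum, hid]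
        simp
    _ ≡ p * a ^ N [MOD p ^ (m + 1)] := (Nat.modEq_zero_iff_dvd.mpr hdvd).add_left _

theorem sum_coprime_pow_modEq_totient {p N : ℕ} (hp : p.Prime) (hodd : Odd p)
    (hN : p - 1 ∣ N) (m : ℕ) (hm : 1 ≤ m) :
    (∑ k ∈ Finset.range (p ^ m), if k.Coprime p then k ^ N else 0) ≡
      (p ^ m).totient [MOD p ^ m] := by
  induction m, hm using Nat.le_induction with
  | base =>
    rw [pow_one, Nat.totient_eq_card_coprime, Finset.card_filter]
    refine Nat.ModEq.sum fun k _ => ?_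
    simp only [Nat.coprime_comm (m := k)]
    split_ifs with hk
    · obtain ⟨c, rfl⟩ := hN
      have h := (Nat.ModEq.pow_totient hk).pow c
      rwa [Nat.totient_prime hp, one_pow, ← pow_mul] at h
    · rfl
  | succ m hm ih =>
    have hstep : (∑ k ∈ Finset.range (p ^ (m + 1)), if k.Coprime p then k ^ N else 0) ≡
        p * ∑ k ∈ Finset.range (p ^ m), (if k.Coprime p then k ^ N else 0)
          [MOD p ^ (m + 1)] := by
      rw [pow_succ p m, sum_range_mul_eq_sum_sum, Finset.mul_sum, ← pow_succ]
      refine Nat.ModEq.sum fun a _ => ?_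
      have hcop : ∀ b, (a + p ^ m * b).Coprime p ↔ a.Coprime p := by
        intro b
        obtain ⟨j, rfl⟩ := Nat.exists_eq_add_of_le' hm
        rw [pow_succ', mul_assoc, Nat.coprime_add_mul_left_left]
      simp only [hcop]
      split_ifs
      · exact sum_range_add_mul_pow_modEq hodd hm a N
      · simp [Nat.ModEq]
    have htot : (p ^ (m + 1)).totient = p * (p ^ m).totient := by
      rw [pow_succ', Nat.totient_mul_of_prime_of_dvd hp (dvd_pow_self p (by lia))]
    rw [htot]
    refine hstep.trans ?_
    rw [pow_succ']
    exact ih.mul_left' p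

theorem stmt_5 (p e : ℕ) (hp : p.Prime) (hodd : Odd p) (he : 2 ≤ e) :
    IsWeakCarmichael (p ^ e) := by
  refine ⟨Nat.one_lt_pow (by lia) hp.one_lt, Nat.Prime.not_prime_pow he, ?_⟩
  have hN : p - 1 ∣ p ^ e - 1 := by simpa using Nat.sub_dvd_pow_sub_pow p 1 e
  have h := sum_coprime_pow_modEq_totient hp hodd hN e (by lia)
  simpa only [carmSum, Finset.sum_filter, Nat.coprime_pow_right_iff (show 0 < e by lia)] using h
end

section
/- If n is a weak Carmichael number, then every power n^e of n with e ≥ 2 is also a weak Carmichael number. -/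
/-- The sum of the `N`-th powers of the residues `k < n` coprime to `n`. -/
def coprimePowSum (n N : ℕ) : ℕ :=
  ∑ k ∈ Finset.filter (fun k => Nat.Coprime k n) (Finset.range n), k ^ N

theorem sum_coprime_eq_sum_units {R : Type*} [AddCommMonoid R] (n : ℕ) [NeZero n]
    (f : ZMod n → R) :
    ∑ k ∈ Finset.filter (fun k => Nat.Coprime k n) (Finset.range n), f (k : ZMod n) =
      ∑ u : (ZMod n)ˣ, f (u : ZMod n) := by
  refine Finset.sum_bij' (fun k hk => ZMod.unitOfCoprime k (Finset.mem_filter.1 hk).2)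
    (fun u _ => (u : ZMod n).val) ?_ ?_ ?_ ?_ ?_
  · intros
    exact Finset.mem_univ _
  · intro u _
    exact Finset.mem_filter.2 ⟨Finset.mem_range.2 (ZMod.val_lt _), ZMod.val_coe_unit_coprime u⟩
  · intro k hk
    simp only [ZMod.coe_unitOfCoprime]
    exact ZMod.val_cast_of_lt (Finset.mem_range.1 (Finset.mem_filter.1 hk).1)
  · intro u _
    ext
    simp
  · intro k hk
    simp

theorem cast_coprimePowSum (n N : ℕ) [NeZero n] :
    (coprimePowSum n N : ZMod n) = ∑ u : (ZMod n)ˣ, (u : ZMod n) ^ N := by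
  rw [← sum_coprime_eq_sum_units n (fun x => x ^ N)]
  simp [coprimePowSum]

theorem coprimePowSum_mul_modEq {q m : ℕ} (hq : q ≠ 0) (hm : m ≠ 0) (h : q.Coprime m) (N : ℕ) :
    coprimePowSum (q * m) N ≡ m.totient * coprimePowSum q N [MOD q] := by
  have : NeZero q := ⟨hq⟩
  have : NeZero m := ⟨hm⟩
  have : NeZero (q * m) := ⟨mul_ne_zero hq hm⟩
  rw [← ZMod.natCast_eq_natCast_iff]
  push_cast
  rw [cast_coprimePowSum]
  have h1 : (coprimePowSum (q * m) N : ZMod q) =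
      ∑ u : (ZMod (q * m))ˣ, ((ZMod.chineseRemainder h (u : ZMod (q * m))).1) ^ N := by
    rw [← sum_coprime_eq_sum_units (q * m) (fun x => ((ZMod.chineseRemainder h x).1) ^ N)]
    simp [coprimePowSum]
  rw [h1]
  let E : (ZMod (q * m))ˣ ≃* (ZMod q)ˣ × (ZMod m)ˣ :=
    (Units.mapEquiv (ZMod.chineseRemainder h).toMulEquiv).trans MulEquiv.prodUnits
  have h2 : ∑ u : (ZMod (q * m))ˣ, ((ZMod.chineseRemainder h (u : ZMod (q * m))).1) ^ N =
      ∑ x : (ZMod q)ˣ × (ZMod m)ˣ, (x.1 : ZMod q) ^ N :=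
    Fintype.sum_equiv E.toEquiv _ _ fun u => rfl
  rw [h2, Fintype.sum_prod_type]
  simp [Finset.mul_sum, ZMod.card_units_eq_totient]

theorem sum_range_mul_eq_sum_sum_s6 {R : Type*} [AddCommMonoid R] (g : ℕ → R) (q r : ℕ) :
    ∑ k ∈ Finset.range (q * r), g k =
      ∑ j ∈ Finset.range q, ∑ i ∈ Finset.range r, g (q * i + j) := by
  rw [Finset.sum_comm]
  induction r with
  | zero => simp
  | succ r ih => rw [Nat.mul_succ, Finset.sum_range_add, ih, Finset.sum_range_succ]

theorem coprimePowSum_mul_of_dvd {q r : ℕ} (hr : Odd r) (h : r ∣ q) (N : ℕ) :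
    coprimePowSum (q * r) N ≡ r * coprimePowSum q N [MOD q * r] := by
  have hc : ∀ i j : ℕ, (q * i + j).Coprime (q * r) ↔ j.Coprime q := by
    intro i j
    rw [Nat.coprime_mul_iff_right]
    have : (q * i + j).Coprime q ↔ j.Coprime q := by simp
    rw [this]
    constructor
    · exact fun h => h.1
    · intro hj
      exact ⟨hj, Nat.Coprime.coprime_dvd_right h (this.2 hj)⟩
  rw [← ZMod.natCast_eq_natCast_iff]
  have hqr : (q : ZMod (q * r)) * r = 0 := by
    exact_mod_cast ZMod.natCast_self (q * r)
  have hqq : (q : ZMod (q * r)) ^ 2 = 0 := by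
    obtain ⟨c, hc⟩ := h
    calc (q : ZMod (q * r)) ^ 2 = q * ((r * c : ℕ) : ZMod (q * r)) := by rw [← hc]; ring
      _ = q * r * c := by push_cast; ring
      _ = 0 := by rw [hqr, zero_mul]
  have hs : (q : ZMod (q * r)) * ∑ i ∈ Finset.range r, (i : ZMod (q * r)) = 0 := by
    obtain ⟨t, ht⟩ := hr
    have : ∑ i ∈ Finset.range r, i = r * t := by
      rw [Finset.sum_range_id, ht]
      simp only [Nat.add_sub_cancel]
      rw [mul_left_comm, Nat.mul_div_cancel_left _ two_pos]
    rw [← Nat.cast_sum, this]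
    push_cast
    rw [← mul_assoc, hqr, zero_mul]
  simp only [coprimePowSum, Finset.sum_filter]
  rw [sum_range_mul_eq_sum_sum_s6]
  push_cast
  rw [Finset.mul_sum]
  refine Finset.sum_congr rfl fun j _ => ?_
  simp only [hc]
  split_ifs with hj
  · have key : ∀ i : ℕ, ((q : ZMod (q * r)) * i + j) ^ N =
        (j : ZMod (q * r)) ^ N + N * (j : ZMod (q * r)) ^ (N - 1) * (q * i) := by
      intro i
      obtain ⟨c, hc⟩ := Polynomial.powAddExpansion (j : ZMod (q * r)) (q * i) N
      rw [add_comm, hc, mul_pow, hqq]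
      ring
    simp only [key]
    rw [Finset.sum_add_distrib, ← Finset.mul_sum, ← Finset.mul_sum, hs]
    simp
  · simp

theorem coprimePowSum_pow_succ {n : ℕ} (hn : Odd n) (N e : ℕ) :
    coprimePowSum (n ^ (e + 1)) N ≡ n ^ e * coprimePowSum n N [MOD n ^ (e + 1)] := by
  induction e with
  | zero => simpa using Nat.ModEq.refl _
  | succ e ih =>
    have h1 := coprimePowSum_mul_of_dvd hn (dvd_pow_self n e.succ_ne_zero) N
    have h2 := Nat.ModEq.mul_left' n ih
    rw [← pow_succ] at h1
    rw [← pow_succ', ← mul_assoc, ← pow_succ'] at h2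
    exact h1.trans h2

theorem coprimePowSum_self_modEq_zero {n N : ℕ} (hn : 2 < n) (hN : Odd N) :
    coprimePowSum n N ≡ 0 [MOD n] := by
  have : NeZero n := ⟨by omega⟩
  have : Fact (2 < n) := ⟨hn⟩
  rw [← ZMod.natCast_eq_natCast_iff, cast_coprimePowSum, Nat.cast_zero]
  refine Finset.sum_involution (fun u _ => -u) ?_ ?_ ?_ ?_
  · intro u _
    simp [hN.neg_pow]
  · intro u _ _ hu
    have h1 : (2 : ZMod n) * u = 0 := by
      have h2 : -(u : ZMod n) = u := by simpa using congrArg Units.val hu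
      linear_combination -h2
    have h3 : ((2 : ℕ) : ZMod n) = 0 := by simpa using h1
    rw [ZMod.natCast_eq_zero_iff] at h3
    exact absurd (Nat.le_of_dvd two_pos h3) (by omega)
  · intros
    exact Finset.mem_univ _
  · intros
    simp

theorem cast_coprimePowSum_prime {p : ℕ} (hp : p.Prime) (N : ℕ) :
    (coprimePowSum p N : ZMod p) = if p - 1 ∣ N then -1 else 0 := by
  have : Fact p.Prime := ⟨hp⟩
  rw [cast_coprimePowSum]
  simpa [ZMod.card] using FiniteField.sum_pow_units (ZMod p) N

theorem IsWeakCarmichael.odd {n : ℕ} (h : IsWeakCarmichael n) : Odd n := by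
  obtain ⟨h1, hp, hs⟩ := h
  by_contra hn
  rw [Nat.not_odd_iff_even] at hn
  have h2 : 2 < n := by
    rcases Nat.lt_or_ge 2 n with h | h
    · exact h
    · exact absurd Nat.prime_two ((show n = 2 by omega) ▸ hp)
  have h3 : coprimePowSum n (n - 1) ≡ 0 [MOD n] :=
    coprimePowSum_self_modEq_zero h2 (Nat.Even.sub_odd (by omega) hn odd_one)
  have h4 : n ∣ n.totient := (Nat.modEq_zero_iff_dvd).1 (hs.symm.trans h3)
  exact absurd (Nat.le_of_dvd (Nat.totient_pos.2 (by omega)) h4)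
    (not_le.2 (Nat.totient_lt n h1))

/-- If the power sum of `p ^ (a + 1) * m` with exponent `N` is congruent to the totient modulo
`p ^ (a + 1)`, it does not change modulo `p ^ (a + 1)` when `N` is replaced by a multiple. -/
theorem coprimePowSum_modEq_of_dvd {p a m N N' : ℕ} (hp : p.Prime) (hodd : Odd p) (hm : m ≠ 0)
    (hc : (p ^ (a + 1)).Coprime m) (hN : N ∣ N')
    (hs : coprimePowSum (p ^ (a + 1) * m) N ≡ (p ^ (a + 1) * m).totient [MOD p ^ (a + 1)]) :
    coprimePowSum (p ^ (a + 1) * m) N' ≡ coprimePowSum (p ^ (a + 1) * m) N [MOD p ^ (a + 1)] := by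
  have hred : ∀ M, coprimePowSum (p ^ (a + 1) * m) M ≡
      m.totient * (p ^ a * coprimePowSum p M) [MOD p ^ (a + 1)] := fun M =>
    (coprimePowSum_mul_modEq (pow_ne_zero _ hp.ne_zero) hm hc M).trans
      ((coprimePowSum_pow_succ hodd M a).mul_left _)
  refine (hred N').trans (Nat.ModEq.trans ?_ (hred N).symm)
  have hzero : ∀ M, p ∣ m.totient * coprimePowSum p M →
      m.totient * (p ^ a * coprimePowSum p M) ≡ 0 [MOD p ^ (a + 1)] := by
    intro M hM
    rw [Nat.modEq_zero_iff_dvd, mul_left_comm, pow_succ]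
    exact mul_dvd_mul_left _ hM
  by_cases hd : p - 1 ∣ N
  · refine Nat.ModEq.mul_left _ ?_
    rw [pow_succ]
    refine Nat.ModEq.mul_left' _ ?_
    rw [← ZMod.natCast_eq_natCast_iff, cast_coprimePowSum_prime hp, cast_coprimePowSum_prime hp,
      if_pos hd, if_pos (hd.trans hN)]
  · have h0 : p ∣ coprimePowSum p N := by
      rw [← ZMod.natCast_eq_zero_iff, cast_coprimePowSum_prime hp, if_neg hd]
    have h1 : p ^ (a + 1) ∣ (p ^ (a + 1) * m).totient :=
      Nat.modEq_zero_iff_dvd.1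
        (hs.symm.trans ((hred N).trans (hzero N (h0.mul_left _))))
    rw [Nat.totient_mul hc, Nat.totient_prime_pow_succ hp, pow_succ, mul_assoc] at h1
    have h2 : p ∣ (p - 1) * m.totient := Nat.dvd_of_mul_dvd_mul_left (pow_pos hp.pos a) h1
    have h3 : p ∣ m.totient := by
      refine (hp.dvd_mul.1 h2).resolve_left fun h => ?_
      have := Nat.le_of_dvd (Nat.sub_pos_of_lt hp.one_lt) h
      have := hp.pos
      omega
    exact (hzero N' (h3.mul_right _)).trans (hzero N (h3.mul_right _)).symm

theorem IsWeakCarmichael.coprimePowSum_modEq {n N : ℕ} (h : IsWeakCarmichael n)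
    (hN : n - 1 ∣ N) : coprimePowSum n N ≡ n.totient [MOD n] := by
  have hodd := h.odd
  obtain ⟨h1, -, hs⟩ := h
  have hn0 : n ≠ 0 := by omega
  refine Nat.ModEq.trans ?_ hs
  rw [Nat.modEq_iff_dvd, Int.natCast_dvd, Nat.dvd_iff_prime_pow_dvd_dvd]
  intro p k hp hk
  rcases Nat.eq_zero_or_pos k with rfl | hk0
  · simp
  have hpn : p ∣ n := (dvd_pow_self p hk0.ne').trans hk
  have hle : k ≤ n.factorization p := (hp.pow_dvd_iff_le_factorization hn0).1 hk
  obtain ⟨a, ha⟩ := Nat.exists_eq_succ_of_ne_zero (show n.factorization p ≠ 0 by omega)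
  rw [ha] at hle
  have hmul : p ^ (a + 1) * (n / p ^ (a + 1)) = n := by
    have := Nat.ordProj_mul_ordCompl_eq_self n p
    rwa [ha] at this
  have hco : (p ^ (a + 1)).Coprime (n / p ^ (a + 1)) := by
    have := Nat.coprime_ordCompl hp hn0
    rw [ha] at this
    exact this.pow_left _
  have hm : n / p ^ (a + 1) ≠ 0 := fun h => hn0 (by rw [← hmul, h, mul_zero])
  have key := coprimePowSum_modEq_of_dvd hp (hodd.of_dvd_nat hpn) hm hco hN
    (by rw [hmul]; exact hs.of_dvd ⟨_, hmul.symm⟩)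
  rw [hmul] at key
  have := (Nat.modEq_iff_dvd.1 (key.of_dvd (pow_dvd_pow p hle)))
  exact Int.natCast_dvd.1 this

theorem totient_pow_succ (n e : ℕ) : (n ^ (e + 1)).totient = n ^ e * n.totient := by
  induction e with
  | zero => simp
  | succ e ih =>
    rcases Nat.eq_zero_or_pos n with rfl | hn
    · simp
    · have h := Nat.totient_gcd_mul_totient_mul n (n ^ (e + 1))
      rw [Nat.gcd_eq_left (dvd_pow_self n e.succ_ne_zero), ← pow_succ', ih] at h
      refine Nat.eq_of_mul_eq_mul_left (Nat.totient_pos.2 hn) (h.trans ?_)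
      ring

theorem stmt_6 (n : ℕ) (h : IsWeakCarmichael n) (e : ℕ) (he : 2 ≤ e) :
    IsWeakCarmichael (n ^ e) := by
  have hodd := h.odd
  refine ⟨Nat.one_lt_pow (by omega) h.1, Nat.Prime.not_prime_pow he, ?_⟩
  obtain ⟨d, rfl⟩ : ∃ d, e = d + 1 := ⟨e - 1, by omega⟩
  have hN : n - 1 ∣ n ^ (d + 1) - 1 := by simpa using Nat.sub_dvd_pow_sub_pow n 1 (d + 1)
  have h1 := coprimePowSum_pow_succ hodd (n ^ (d + 1) - 1) d
  have h2 := Nat.ModEq.mul_left' (n ^ d) (h.coprimePowSum_modEq hN)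
  rw [← pow_succ, ← totient_pow_succ] at h2
  exact h1.trans h2
end

section
/- If n = p·q is a product of two distinct odd primes p and q, then n is not a weak Carmichael number; that is, ∑_{1 ≤ k ≤ pq−1, gcd(k,pq)=1} k^{pq−1} ≢ φ(pq) (mod pq). -/
theorem sum_range_natCast_zmod {M : Type*} [AddCommMonoid M] (q : ℕ) [NeZero q]
    (f : ZMod q → M) : ∑ k ∈ Finset.range q, f k = ∑ x, f x := by
  refine Finset.sum_bij (fun k _ => (k : ZMod q)) (fun _ _ => Finset.mem_univ _) ?_ ?_
    (fun _ _ => rfl)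
  · intro a ha b hb h
    rw [ZMod.natCast_eq_natCast_iff] at h
    exact h.eq_of_lt_of_lt (Finset.mem_range.mp ha) (Finset.mem_range.mp hb)
  · intro x _
    exact ⟨x.val, Finset.mem_range.mpr x.val_lt, ZMod.natCast_zmod_val x⟩

theorem sum_range_mul_natCast_zmod {M : Type*} [AddCommMonoid M] (p q : ℕ) [NeZero q]
    (f : ZMod q → M) : ∑ k ∈ Finset.range (p * q), f k = p • ∑ x, f x := by
  induction p with
  | zero => simp
  | succ p ih =>
    rw [add_mul, one_mul, Finset.sum_range_add, ih, add_smul, one_smul,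
      ← sum_range_natCast_zmod q f]
    simp

theorem ZMod.sum_pow_mul_sub_one_eq_zero {p q : ℕ} [Fact q.Prime] (hp : 2 ≤ p) (hpq : p < q) :
    ∑ x : ZMod q, x ^ (p * q - 1) = 0 := by
  have hpow (x : ZMod q) : x ^ (p * q - 1) = x ^ (p - 1) := by
    obtain ⟨m, rfl⟩ := Nat.exists_eq_add_of_le hp
    have h₁ : (2 + m) * q - 1 = q * (m + 1) + (q - 1) := by
      have : (2 + m) * q = q * (m + 1) + q := by ring
      omega
    have h₂ : m + 1 + (q - 1) = q + m := by omega
    have h₃ : 2 + m - 1 = 1 + m := by omega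
    rw [h₁, pow_add, pow_mul, ZMod.pow_card, ← pow_add, h₂, pow_add, ZMod.pow_card, h₃,
      pow_add, pow_one]
  simp_rw [hpow]
  apply FiniteField.sum_pow_lt_card_sub_one
  rw [ZMod.card]
  omega

theorem carmSum_mul_natCast_eq_zero {p q : ℕ} (hp : p.Prime) [Fact q.Prime] (hpq : p < q) :
    (carmSum (p * q) : ZMod q) = 0 := by
  have hq : q.Prime := Fact.out
  have hN : p * q - 1 ≠ 0 := by
    have := Nat.mul_le_mul hp.two_le hq.two_le
    omega
  have hS := ZMod.sum_pow_mul_sub_one_eq_zero hp.two_le hpq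
  have hall : ∑ k ∈ Finset.range (p * q), (k : ZMod q) ^ (p * q - 1) = 0 := by
    rw [sum_range_mul_natCast_zmod p q (fun x => x ^ (p * q - 1)), hS, smul_zero]
  have himage : (Finset.range (p * q)).filter (p ∣ ·) = (Finset.range q).image (p * ·) := by
    ext k
    simp only [Finset.mem_filter, Finset.mem_range, Finset.mem_image]
    constructor
    · rintro ⟨hk, j, rfl⟩
      exact ⟨j, Nat.lt_of_mul_lt_mul_left hk, rfl⟩
    · rintro ⟨j, hj, rfl⟩
      exact ⟨Nat.mul_lt_mul_of_pos_left hj hp.pos, dvd_mul_right p j⟩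
  have hdvd : ∑ k ∈ (Finset.range (p * q)).filter (p ∣ ·), (k : ZMod q) ^ (p * q - 1) = 0 := by
    rw [himage, Finset.sum_image fun a _ b _ h => Nat.eq_of_mul_eq_mul_left hp.pos h]
    simp_rw [Nat.cast_mul, mul_pow]
    rw [← Finset.mul_sum, sum_range_natCast_zmod q (fun x => x ^ (p * q - 1)), hS, mul_zero]
  have hndvd :
      ∑ k ∈ (Finset.range (p * q)).filter (¬ p ∣ ·), (k : ZMod q) ^ (p * q - 1) = 0 := by
    rw [← Finset.sum_filter_add_sum_filter_not _ (p ∣ ·), hdvd, zero_add] at hall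
    exact hall
  rw [carmSum, Nat.cast_sum, ← hndvd]
  simp_rw [Nat.cast_pow]
  apply Finset.sum_subset
  · intro k
    simp only [Finset.mem_filter]
    rintro ⟨hk, hc⟩
    exact ⟨hk, hp.coprime_iff_not_dvd.mp (Nat.Coprime.coprime_mul_right_right hc).symm⟩
  · intro k hk hk'
    simp only [Finset.mem_filter] at hk hk'
    have hqk : q ∣ k := by
      by_contra h
      exact hk' ⟨hk.1, Nat.Coprime.mul_right (hp.coprime_iff_not_dvd.mpr hk.2).symm
        (hq.coprime_iff_not_dvd.mpr h).symm⟩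
    rw [(ZMod.natCast_eq_zero_iff k q).mpr hqk, zero_pow hN]

theorem not_carmSum_mul_modEq_totient_of_lt {p q : ℕ} (hp : p.Prime) (hq : q.Prime)
    (hpq : p < q) : ¬ carmSum (p * q) ≡ (p * q).totient [MOD p * q] := by
  intro h
  have := Fact.mk hq
  have hz := (ZMod.natCast_eq_natCast_iff _ _ _).mpr (h.of_mul_left p)
  rw [carmSum_mul_natCast_eq_zero hp hpq, eq_comm, ZMod.natCast_eq_zero_iff,
    Nat.totient_mul ((Nat.coprime_primes hp hq).mpr hpq.ne), Nat.totient_prime hp,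
    Nat.totient_prime hq] at hz
  have := hp.two_le
  rcases hq.dvd_mul.mp hz with h | h
  · have := Nat.le_of_dvd (by omega) h
    omega
  · have := Nat.le_of_dvd (by omega) h
    omega

theorem stmt_7 (p q : ℕ) (hp : p.Prime) (hq : q.Prime) (hpodd : Odd p)
    (hqodd : Odd q) (hpq : p ≠ q) :
    ¬ (carmSum (p * q) ≡ (p * q).totient [MOD p * q]) := by
  rcases hpq.lt_or_gt with h | h
  · exact not_carmSum_mul_modEq_totient_of_lt hp hq h
  · rw [mul_comm p q]
    exact not_carmSum_mul_modEq_totient_of_lt hq hp h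
end

section
/- A composite positive integer n is a Carmichael number if and only if n is a weak Carmichael number and rad(φ(n)) divides n − 1, where rad(m) denotes the radical of m, i.e., the product of the distinct primes dividing m. -/
/-- The radical of `m`: the product of the distinct primes dividing `m`. -/
def rad (m : ℕ) : ℕ := ∏ p ∈ m.primeFactors, p

theorem sum_units_pow_mul {R : Type*} [CommRing R] [Fintype Rˣ] (v : Rˣ) (m : ℕ) :
    (∑ u : Rˣ, (u : R) ^ m) * (v : R) ^ m = ∑ u : Rˣ, (u : R) ^ m := by
  rw [Finset.sum_mul]
  exact Fintype.sum_equiv (Equiv.mulRight v) _ _ fun u => by simp [mul_pow]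

theorem forall_coprime_pow_modEq_one_iff (n m : ℕ) [NeZero n] :
    (∀ a : ℕ, Nat.Coprime a n → a ^ m ≡ 1 [MOD n]) ↔ ∀ u : (ZMod n)ˣ, u ^ m = 1 := by
  constructor
  · intro h u
    have hu := h _ (ZMod.val_coe_unit_coprime u)
    rw [← ZMod.natCast_eq_natCast_iff] at hu
    exact Units.ext (by simpa using hu)
  · intro h a ha
    rw [← ZMod.natCast_eq_natCast_iff]
    simpa using congrArg Units.val (h (ZMod.unitOfCoprime a ha))

theorem rad_dvd_iff {m k : ℕ} (hm : m ≠ 0) :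
    rad m ∣ k ↔ ∀ p : ℕ, p.Prime → p ∣ m → p ∣ k := by
  constructor
  · intro h p hp hpm
    exact (Finset.dvd_prod_of_mem _ (Nat.mem_primeFactors.2 ⟨hp, hpm, hm⟩)).trans h
  · intro h
    refine Finset.prod_primes_dvd k (fun p hp => (Nat.prime_of_mem_primeFactors hp).prime)
      fun p hp => h p (Nat.prime_of_mem_primeFactors hp) (Nat.dvd_of_mem_primeFactors hp)

theorem stmt_14 (n : ℕ) (hn : 1 < n) (hnp : ¬ n.Prime) :
    IsCarmichael n ↔ IsWeakCarmichael n ∧ rad n.totient ∣ n - 1 := by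
  have : NeZero n := ⟨by omega⟩
  have htot : n.totient ≠ 0 := (Nat.totient_pos.2 (by omega)).ne'
  have hCarmichael : IsCarmichael n ↔ ∀ u : (ZMod n)ˣ, u ^ (n - 1) = 1 := by
    rw [← forall_coprime_pow_modEq_one_iff]
    exact ⟨fun h => h.2.2, fun h => ⟨hn, hnp, h⟩⟩
  have hWeak : IsWeakCarmichael n ↔
      ∑ u : (ZMod n)ˣ, (u : ZMod n) ^ (n - 1) = (n.totient : ZMod n) := by
    rw [← carmSum_cast, ZMod.natCast_eq_natCast_iff]
    exact ⟨fun h => h.2.2, fun h => ⟨hn, hnp, h⟩⟩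
  rw [hCarmichael, hWeak, rad_dvd_iff htot]
  constructor
  · intro h
    refine ⟨?_, fun p hp hpn => ?_⟩
    · simp [← Units.val_pow_eq_pow_val, h, ZMod.card_units_eq_totient]
    · have : Fact p.Prime := ⟨hp⟩
      rw [← ZMod.card_units_eq_totient] at hpn
      obtain ⟨u, hu⟩ := exists_prime_orderOf_dvd_card p hpn
      exact hu ▸ orderOf_dvd_of_pow_eq_one (h u)
  · rintro ⟨hsum, hrad⟩ v
    have hcop : Nat.Coprime n.totient n := Nat.coprime_of_dvd fun p hp hpt hpn =>
      hp.one_lt.ne' (Nat.dvd_one.1 ((Nat.dvd_sub_iff_right hn.le hpn).1 (hrad p hp hpt)))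
    have hmul := sum_units_pow_mul v (n - 1)
    rw [hsum] at hmul
    have hunit : IsUnit (n.totient : ZMod n) := (ZMod.isUnit_iff_coprime _ _).2 hcop
    exact Units.ext (by simpa using hunit.mul_eq_left.1 hmul)
end
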